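/- arXiv:2303.12147 — 2 statements merged into one kernel-verified Lean document; each statement's English description precedes it below -/
import Mathlib

section
/- Let σ : ℝ → ℝ be Lipschitz continuous and not equal to any polynomial. Then for every compact set Ω ⊂ ℝⁿ, every continuous function f : Ω → ℝⁿ, and every ε > 0, there exist N ∈ ℕ, matrices A_j ∈ ℝ^{n×n}, invertible matrices W_j ∈ ℝ^{n×n}, and vectors b_j ∈ ℝⁿ for j = 0,…,N−1 such that sup_{x ∈ Ω} ‖f(x) − Σ_{j=0}^{N−1} A_j σ(W_j x + b_j)‖ ≤ ε. That is, sums of the form Σ_j A_j σ(W_j x + b_j) with all W_j invertible are dense in C(Ω; ℝⁿ) for the supremum norm. -/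
open Matrix

/-- Euclidean norm of a finitely-indexed real vector. -/
noncomputable def euclNorm {m : Type*} [Fintype m] (v : m → ℝ) : ℝ :=
  Real.sqrt (∑ i, v i ^ 2)

/-- Entrywise application of a scalar function to a vector. -/
def entApp {m : Type*} (σ : ℝ → ℝ) (v : m → ℝ) : m → ℝ := fun i => σ (v i)

open MeasureTheory Filter Topology

/-- A smooth function whose `k`-th derivative vanishes is a polynomial of degree less than `k`. -/
lemma exists_eq_sum_of_iteratedDeriv_eq_zero (k : ℕ) :
    ∀ g : ℝ → ℝ, ContDiff ℝ (⊤ : ℕ∞) g → (∀ x, iteratedDeriv k g x = 0) →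
      ∃ c : ℕ → ℝ, ∀ x, g x = ∑ i ∈ Finset.range k, c i * x ^ i := by
  induction k with
  | zero => intro g _ h; exact ⟨0, by simpa using h⟩
  | succ k ih =>
    intro g hg h
    have hg' : ContDiff ℝ (⊤ : ℕ∞) (deriv g) := hg.deriv'
    obtain ⟨c, hc⟩ := ih (deriv g) hg' (fun x => by rw [← iteratedDeriv_succ', h])
    have hd : ∀ x, HasDerivAt
        (fun x => g x - ∑ i ∈ Finset.range k, c i / (i + 1) * x ^ (i + 1)) 0 x := by
      intro x
      have h1 : HasDerivAt g (deriv g x) x := (hg.differentiable (by simp) x).hasDerivAt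
      have h2 : HasDerivAt (fun x : ℝ => ∑ i ∈ Finset.range k, c i / (i + 1) * x ^ (i + 1))
          (∑ i ∈ Finset.range k, c i * x ^ i) x := by
        refine HasDerivAt.fun_sum fun i _ => ?_
        refine ((hasDerivAt_pow (i + 1) x).const_mul (c i / (i + 1))).congr_deriv ?_
        push_cast
        field_simp
      exact (h1.fun_sub h2).congr_deriv (by simp [hc])
    have hconst := is_const_of_deriv_eq_zero (fun x => (hd x).differentiableAt)
      (fun x => (hd x).deriv)
    refine ⟨fun i => Nat.casesOn i (g 0) fun j => c j / (j + 1), fun x => ?_⟩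
    have := hconst x 0
    simp only [Finset.sum_range_succ']
    simp at this ⊢
    linarith

/-- Pointwise limits of polynomials of bounded degree are polynomials. -/
lemma exists_polynomial_of_tendsto (k : ℕ) (g : ℕ → ℝ → ℝ) (σ : ℝ → ℝ)
    (hg : ∀ m, ∃ c : ℕ → ℝ, ∀ x, g m x = ∑ i ∈ Finset.range k, c i * x ^ i)
    (hlim : ∀ x, Tendsto (fun m => g m x) atTop (𝓝 (σ x))) :
    ∃ P : Polynomial ℝ, ∀ x : ℝ, σ x = P.eval x := by
  let S : Submodule ℝ (ℝ → ℝ) := Submodule.span ℝ (Set.range fun (i : Fin k) (x : ℝ) => x ^ (i : ℕ))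
  have : FiniteDimensional ℝ S := FiniteDimensional.span_of_finite ℝ (Set.finite_range _)
  have hmem : σ ∈ S := by
    refine S.closed_of_finiteDimensional.mem_of_tendsto (tendsto_pi_nhds.2 hlim)
      (Eventually.of_forall fun m => ?_)
    obtain ⟨c, hc⟩ := hg m
    refine (Submodule.mem_span_range_iff_exists_fun ℝ).2 ⟨fun i => c i, ?_⟩
    ext x
    simp [hc, Finset.sum_range]
  obtain ⟨c, hc⟩ := (Submodule.mem_span_range_iff_exists_fun ℝ).1 hmem
  refine ⟨∑ i, Polynomial.C (c i) * Polynomial.X ^ (i : ℕ), fun x => ?_⟩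
  simp [← hc, Polynomial.eval_finsetSum]

/-- For each `k`, a non-polynomial continuous function has a mollification whose `k`-th derivative
does not vanish identically. -/
lemma exists_bump_iteratedDeriv_ne_zero (σ : ℝ → ℝ) (hσ : Continuous σ)
    (hσpoly : ¬ ∃ P : Polynomial ℝ, ∀ x : ℝ, σ x = P.eval x) (k : ℕ) :
    ∃ (φ : ContDiffBump (0 : ℝ)) (x : ℝ), iteratedDeriv k
      (convolution (φ.normed volume) σ (ContinuousLinearMap.lsmul ℝ ℝ) volume) x ≠ 0 := by
  by_contra! h
  let φ : ℕ → ContDiffBump (0 : ℝ) := fun m =>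
    ⟨1 / (m + 1) / 2, 1 / (m + 1), by positivity, by
      have : (0 : ℝ) < 1 / (m + 1) := by positivity
      linarith⟩
  refine hσpoly (exists_polynomial_of_tendsto k
    (fun m => convolution ((φ m).normed volume) σ (ContinuousLinearMap.lsmul ℝ ℝ) volume) σ
    (fun m => exists_eq_sum_of_iteratedDeriv_eq_zero k _ ?_ (h (φ m))) fun x => ?_)
  · exact (φ m).hasCompactSupport_normed.contDiff_convolution_left _ (φ m).contDiff_normed
      hσ.locallyIntegrable
  · exact ContDiffBump.convolution_tendsto_right_of_continuous
      tendsto_one_div_add_atTop_nhds_zero_nat hσ x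

section Annihilator

variable {X E : Type*} [TopologicalSpace X] [CompactSpace X] [NormedAddCommGroup E]
  [NormedSpace ℝ E] [CompleteSpace E]

/-- An operator annihilating all affine substitutions in `σ` annihilates those in the
mollifications of `σ`. -/
lemma map_convolution_comp_eq_zero (L : C(X, ℝ) →L[ℝ] E) (u : C(X, ℝ)) (σ g : C(ℝ, ℝ))
    (φ : ℝ → ℝ) (hφ : Continuous φ) (hφc : HasCompactSupport φ)
    (hg : ∀ x, g x = convolution φ σ (ContinuousLinearMap.lsmul ℝ ℝ) volume x)
    (h : ∀ a b : ℝ, L (σ.comp (a • u + ContinuousMap.const X b)) = 0) (a b : ℝ) :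
    L (g.comp (a • u + ContinuousMap.const X b)) = 0 := by
  let Φ : C(ℝ, C(X, ℝ)) := ContinuousMap.curry
    ⟨fun p : ℝ × X => φ p.1 * σ (a * u p.2 + b - p.1), by fun_prop⟩
  have hΦ : ∀ t, Φ t = φ t • σ.comp (a • u + ContinuousMap.const X (b - t)) := by
    intro t
    ext x
    simp [Φ, add_sub_assoc]
  have hint : Integrable (fun t => Φ t) := by
    refine Φ.continuous.integrable_of_hasCompactSupport (hφc.mono fun t ht hφt => ht ?_)
    simp [hΦ, hφt]
  have heq : g.comp (a • u + ContinuousMap.const X b) = ∫ t, Φ t := by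
    ext x
    rw [ContinuousMap.integral_apply hint]
    simp [hg, convolution, Φ]
  rw [heq, ← L.integral_comp_comm hint]
  simp [hΦ, h]

lemma map_mul_deriv_comp_eq_zero (L : C(X, ℝ) →L[ℝ] E) (u v : C(X, ℝ)) (g g' : C(ℝ, ℝ))
    (hg : ∀ x, HasDerivAt g (g' x) x)
    (h : ∀ a b : ℝ, L (v * g.comp (a • u + ContinuousMap.const X b)) = 0) (a b : ℝ) :
    L (v * u * g'.comp (a • u + ContinuousMap.const X b)) = 0 := by
  let Φ : C(ℝ, C(X, ℝ)) := ContinuousMap.curry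
    ⟨fun p : ℝ × X => v p.2 * u p.2 * g' (p.1 * u p.2 + b), by fun_prop⟩
  have hΦ : ∀ t, Φ t = v * u * g'.comp (t • u + ContinuousMap.const X b) := by
    intro t
    ext x
    simp [Φ]
  have hint : ∀ c : ℝ, ∫ t in (0 : ℝ)..c, Φ t = v * g.comp (c • u + ContinuousMap.const X b)
      - v * g.comp ((0 : ℝ) • u + ContinuousMap.const X b) := by
    intro c
    ext x
    have hi : IntervalIntegrable Φ volume 0 c := Φ.continuous.intervalIntegrable _ _
    have h1 := (ContinuousMap.evalCLM ℝ x).intervalIntegral_comp_comm hi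
    have h2 : ∫ t in (0 : ℝ)..c, v x * u x * g' (t * u x + b)
        = v x * g (c * u x + b) - v x * g (0 * u x + b) := by
      refine intervalIntegral.integral_eq_sub_of_hasDerivAt (f := fun t => v x * g (t * u x + b))
        (fun t _ => ?_) (Continuous.intervalIntegrable (by fun_prop) _ _)
      refine (((hg (t * u x + b)).comp t
        (((hasDerivAt_id t).mul_const (u x)).add_const b)).const_mul (v x)).congr_deriv ?_
      ring
    simp [Φ] at h1 h2 ⊢
    rw [← h1, h2]
  have hzero : (fun c : ℝ => ∫ t in (0 : ℝ)..c, L (Φ t)) = fun _ => 0 := by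
    funext c
    rw [L.intervalIntegral_comp_comm (Φ.continuous.intervalIntegrable _ _), hint, map_sub, h, h,
      sub_zero]
  have hcont : Continuous fun t => L (Φ t) := L.continuous.comp Φ.continuous
  have := hcont.deriv_integral _ 0 a
  rw [hzero] at this
  simpa [hΦ] using this.symm

lemma map_pow_eq_zero (L : C(X, ℝ) →L[ℝ] E) (u : C(X, ℝ)) (σ : C(ℝ, ℝ))
    (hσpoly : ¬ ∃ P : Polynomial ℝ, ∀ x : ℝ, σ x = P.eval x)
    (h : ∀ a b : ℝ, L (σ.comp (a • u + ContinuousMap.const X b)) = 0) (k : ℕ) :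
    L (u ^ k) = 0 := by
  obtain ⟨φ, y, hy⟩ := exists_bump_iteratedDeriv_ne_zero σ σ.continuous hσpoly k
  set g : ℝ → ℝ := convolution (φ.normed volume) σ (ContinuousLinearMap.lsmul ℝ ℝ) volume with hgdef
  have hg : ContDiff ℝ (⊤ : ℕ∞) g :=
    φ.hasCompactSupport_normed.contDiff_convolution_left _ φ.contDiff_normed
      σ.continuous.locallyIntegrable
  have hgi : ∀ j, Continuous (iteratedDeriv j g) := fun j =>
    hg.continuous_iteratedDeriv j (by exact_mod_cast le_top)
  have key : ∀ j, ∀ a b : ℝ, L (u ^ j *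
      (⟨iteratedDeriv j g, hgi j⟩ : C(ℝ, ℝ)).comp (a • u + ContinuousMap.const X b)) = 0 := by
    intro j
    induction j with
    | zero =>
      intro a b
      rw [pow_zero, one_mul]
      exact map_convolution_comp_eq_zero L u σ _ _ (φ.continuous_normed (μ := volume)) φ.hasCompactSupport_normed
        (fun x => by simp [hgdef]) h a b
    | succ j ih =>
      intro a b
      rw [pow_succ]
      refine map_mul_deriv_comp_eq_zero L u (u ^ j) _ _ (fun x => ?_) ih a b
      simp only [ContinuousMap.coe_mk]
      rw [iteratedDeriv_succ]
      exact ((hg.differentiable_iteratedDeriv j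
        (by exact_mod_cast WithTop.coe_lt_top _)) x).hasDerivAt
  have h0 := key k 0 y
  have heq : u ^ k * (⟨iteratedDeriv k g, hgi k⟩ : C(ℝ, ℝ)).comp
      ((0 : ℝ) • u + ContinuousMap.const X y) = iteratedDeriv k g y • u ^ k := by
    ext x
    simp [mul_comm]
  rw [heq, map_smul] at h0
  exact (smul_eq_zero.1 h0).resolve_left hy

omit [CompleteSpace E] in
lemma map_exp_eq_zero (L : C(X, ℝ) →L[ℝ] E) (u : C(X, ℝ)) (h : ∀ k : ℕ, L (u ^ k) = 0) :
    L (NormedSpace.exp u) = 0 := by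
  have h1 := (NormedSpace.exp_series_hasSum_exp' (𝕂 := ℝ) u).mapL L
  simp only [map_smul, h, smul_zero] at h1
  exact h1.unique hasSum_zero

omit [CompleteSpace E] in
/-- An operator annihilating the exponentials of an additive point-separating family is zero. -/
lemma eq_zero_of_map_exp_eq_zero {F : Type*} [AddCommGroup F] (L : C(X, ℝ) →L[ℝ] E)
    (u : F →+ C(X, ℝ)) (hu : ∀ x y : X, x ≠ y → ∃ w, u w x ≠ u w y)
    (h : ∀ w, L (NormedSpace.exp (u w)) = 0) : L = 0 := by
  let M : Submonoid C(X, ℝ) :=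
    { carrier := Set.range fun w => NormedSpace.exp (u w)
      one_mem' := ⟨0, by simp⟩
      mul_mem' := by
        rintro _ _ ⟨w, rfl⟩ ⟨w', rfl⟩
        exact ⟨w + w', by simp [NormedSpace.exp_add]⟩ }
  let A : Subalgebra ℝ C(X, ℝ) := Algebra.adjoin ℝ (M : Set C(X, ℝ))
  have hA : ∀ p ∈ A, L p = 0 := by
    intro p hp
    rw [← Subalgebra.mem_toSubmodule, Algebra.adjoin_eq_span, Submonoid.closure_eq] at hp
    have : Submodule.span ℝ (M : Set C(X, ℝ)) ≤ LinearMap.ker L.toLinearMap := by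
      rw [Submodule.span_le]
      rintro _ ⟨w, rfl⟩
      exact h w
    exact this hp
  have hsep : A.SeparatesPoints := by
    intro x y hxy
    obtain ⟨w, hw⟩ := hu x y hxy
    refine ⟨_, ⟨NormedSpace.exp (u w), Algebra.subset_adjoin ⟨w, rfl⟩, rfl⟩, ?_⟩
    have heval : ∀ z, NormedSpace.exp (u w) z = Real.exp (u w z) := by
      intro z
      rw [Real.exp_eq_exp_ℝ]
      exact NormedSpace.map_exp (ContinuousMap.evalAlgHom ℝ ℝ z)
        (continuous_eval_const z) (u w)
    simpa [heval] using hw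
  ext p
  have hp := ContinuousMap.continuousMap_mem_subalgebra_closure_of_separatesPoints A hsep p
  have hcl : A.topologicalClosure.carrier ⊆ {p | L p = 0} :=
    closure_minimal hA (isClosed_eq L.continuous continuous_const)
  exact hcl hp

end Annihilator

section Ridge

variable {n : ℕ} (Ω : Set (Fin n → ℝ))

/-- The linear functional `x ↦ w ⬝ᵥ x` restricted to a set, additively in `w`. -/
def dotProductHom : (Fin n → ℝ) →+ C(Ω, ℝ) :=
  AddMonoidHom.mk' (fun w => ⟨fun x => w ⬝ᵥ x.1, by fun_prop⟩) fun w w' => by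
    ext x
    simp [add_dotProduct]

@[simp]
lemma dotProductHom_apply (w : Fin n → ℝ) (x : Ω) : dotProductHom Ω w x = w ⬝ᵥ x.1 := rfl

/-- Ridge functions with nonzero direction and a continuous non-polynomial profile have dense span
in the continuous functions on a compact set. -/
lemma dense_span_ridge [NeZero n] [CompactSpace Ω] (σ : C(ℝ, ℝ))
    (hσpoly : ¬ ∃ P : Polynomial ℝ, ∀ x : ℝ, σ x = P.eval x) :
    (Submodule.span ℝ (Set.range fun p : {w : Fin n → ℝ // w ≠ 0} × ℝ =>
      σ.comp (dotProductHom Ω p.1 + ContinuousMap.const Ω p.2))).topologicalClosure = ⊤ := by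
  set V := (Submodule.span ℝ (Set.range fun p : {w : Fin n → ℝ // w ≠ 0} × ℝ =>
      σ.comp (dotProductHom Ω p.1 + ContinuousMap.const Ω p.2))).topologicalClosure with hV
  have hVc : IsClosed (V : Set C(Ω, ℝ)) := Submodule.isClosed_topologicalClosure _
  have hridge : ∀ (w : Fin n → ℝ) (b : ℝ),
      V.mkQL (σ.comp (dotProductHom Ω w + ContinuousMap.const Ω b)) = 0 := by
    intro w b
    let Φ : C(Fin n → ℝ, C(Ω, ℝ)) := ContinuousMap.curry
      ⟨fun p : (Fin n → ℝ) × Ω => σ (p.1 ⬝ᵥ p.2.1 + b), by fun_prop⟩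
    have hΦ : ∀ w, Φ w = σ.comp (dotProductHom Ω w + ContinuousMap.const Ω b) := fun _ => rfl
    have heq : (fun w => V.mkQL (Φ w)) = fun _ => 0 := by
      refine Continuous.ext_on (dense_compl_singleton (0 : Fin n → ℝ))
        (V.mkQL.continuous.comp Φ.continuous) continuous_const fun w hw => ?_
      simp only [Submodule.mkQL_apply, Submodule.mkQ_apply, Submodule.Quotient.mk_eq_zero]
      exact Submodule.le_topologicalClosure _ (Submodule.subset_span ⟨(⟨w, hw⟩, b), rfl⟩)
    exact congrFun heq w
  have hzero : V.mkQL = 0 := by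
    refine eq_zero_of_map_exp_eq_zero (E := C(Ω, ℝ) ⧸ V) V.mkQL (dotProductHom Ω) (fun x y hxy => ?_) fun w =>
      map_exp_eq_zero _ _ (map_pow_eq_zero _ _ σ hσpoly fun a b => ?_)
    · obtain ⟨i, hi⟩ := Function.ne_iff.1 (Subtype.coe_ne_coe.2 hxy)
      exact ⟨Pi.single i 1, by simpa using hi⟩
    · have : a • dotProductHom Ω w = dotProductHom Ω (a • w) := by
        ext x
        simp [smul_dotProduct]
      rw [this, hridge]
  refine eq_top_iff.2 fun p _ => ?_
  have := DFunLike.congr_fun hzero p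
  simpa using this

/-- Uniform approximation of a continuous scalar function by finite sums of ridge functions. -/
lemma exists_ridge_approx [NeZero n] (σ : ℝ → ℝ) (hσ : Continuous σ)
    (hσpoly : ¬ ∃ P : Polynomial ℝ, ∀ x : ℝ, σ x = P.eval x) (hΩ : IsCompact Ω)
    (f : (Fin n → ℝ) → ℝ) (hf : ContinuousOn f Ω) (δ : ℝ) (hδ : 0 < δ) :
    ∃ c : {w : Fin n → ℝ // w ≠ 0} × ℝ →₀ ℝ, ∀ x ∈ Ω,
      |f x - ∑ p ∈ c.support, c p * σ (p.1.1 ⬝ᵥ x + p.2)| ≤ δ := by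
  have : CompactSpace Ω := isCompact_iff_compactSpace.1 hΩ
  let F : C(Ω, ℝ) := ⟨fun x => f x, hf.domRestrict⟩
  have hF : F ∈ (Submodule.span ℝ (Set.range fun p : {w : Fin n → ℝ // w ≠ 0} × ℝ =>
      (⟨σ, hσ⟩ : C(ℝ, ℝ)).comp
        (dotProductHom Ω p.1 + ContinuousMap.const Ω p.2))).topologicalClosure := by
    rw [dense_span_ridge Ω ⟨σ, hσ⟩ hσpoly]
    trivial
  obtain ⟨q, hq, hd⟩ := Metric.mem_closure_iff.1 hF δ hδ
  obtain ⟨c, rfl⟩ := Finsupp.mem_span_range_iff_exists_finsupp.1 hq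
  refine ⟨c, fun x hx => ?_⟩
  have := (ContinuousMap.dist_apply_le_dist (f := F) ⟨x, hx⟩).trans hd.le
  simpa [Real.dist_eq, show F ⟨x, hx⟩ = f x from rfl, Finsupp.sum] using this

end Ridge

lemma exists_det_ne_zero_row_eq {n : ℕ} (w : Fin n → ℝ) (hw : w ≠ 0) :
    ∃ (W : Matrix (Fin n) (Fin n) ℝ) (r : Fin n), W.det ≠ 0 ∧ W r = w := by
  obtain ⟨r, hr⟩ := Function.ne_iff.1 hw
  refine ⟨updateRow 1 r w, r, ?_, updateRow_self⟩
  rw [← cramer_transpose_apply]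
  simpa using hr

lemma Finset.exists_sum_eq_sum_range {ι M : Type*} [Nonempty ι] [AddCommMonoid M] (s : Finset ι) :
    ∃ e : ℕ → ι, ∀ F : ι → M, ∑ i ∈ s, F i = ∑ j ∈ Finset.range s.card, F (e j) := by
  classical
  let d : ι := Classical.arbitrary ι
  refine ⟨fun j => s.toList.getD j d, fun F => ?_⟩
  rw [← Finset.sum_map_toList, ← Finset.length_toList, Finset.sum_range, ← List.sum_ofFn]
  congr 1
  refine List.ext_getElem (by simp) fun i h1 h2 => ?_
  simp at h1 h2
  simp

lemma euclNorm_le_of_abs_le {m : Type*} [Fintype m] [Nonempty m] (v : m → ℝ) {ε : ℝ} (hε : 0 ≤ ε)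
    (h : ∀ i, |v i| ≤ ε / Fintype.card m) : euclNorm v ≤ ε := by
  refine (Real.sqrt_le_left hε).2 ?_
  have hsum : ∑ i, |v i| ≤ ε := by
    refine (Finset.sum_le_sum fun i _ => h i).trans_eq ?_
    simp
    field_simp
  calc ∑ i, v i ^ 2 = ∑ i, |v i| ^ 2 := by simp
    _ ≤ (∑ i, |v i|) ^ 2 := Finset.sum_sq_le_sq_sum_of_nonneg fun i _ => abs_nonneg _
    _ ≤ ε ^ 2 := by gcongr

/-- UAP with invertible inner matrices: for Lipschitz non-polynomial `σ`, sums
`Σ_j A_j σ(W_j x + b_j)` with all `W_j` invertible are dense in `C(Ω; ℝⁿ)`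
for the supremum norm. -/
theorem shallow_UAP_invertible_weights {n : ℕ} (σ : ℝ → ℝ)
    (hσLip : ∃ K : NNReal, LipschitzWith K σ)
    (hσpoly : ¬ ∃ P : Polynomial ℝ, ∀ x : ℝ, σ x = P.eval x)
    (Ω : Set (Fin n → ℝ)) (hΩ : IsCompact Ω)
    (f : (Fin n → ℝ) → (Fin n → ℝ)) (hf : ContinuousOn f Ω)
    (ε : ℝ) (hε : 0 < ε) :
    ∃ (N : ℕ) (A W : ℕ → Matrix (Fin n) (Fin n) ℝ) (b : ℕ → (Fin n → ℝ)),
      (∀ j < N, (W j).det ≠ 0) ∧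
      ∀ x ∈ Ω,
        euclNorm (f x - ∑ j ∈ Finset.range N, (A j).mulVec (entApp σ ((W j).mulVec x + b j)))
          ≤ ε := by
  obtain ⟨K, hK⟩ := hσLip
  rcases Nat.eq_zero_or_pos n with rfl | hn
  · exact ⟨0, 0, 0, 0, by simp, fun x _ => by simpa [euclNorm] using hε.le⟩
  have : NeZero n := ⟨hn.ne'⟩
  have hδ : 0 < ε / Fintype.card (Fin n) := by
    simp only [Fintype.card_fin]
    positivity
  choose c hc using fun i => exists_ridge_approx Ω σ hK.continuous hσpoly hΩ (fun x => f x i)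
    ((continuous_apply i).comp_continuousOn hf) _ hδ
  choose W r hdet hrow using exists_det_ne_zero_row_eq (n := n)
  let ι := (_ : Fin n) × ({w : Fin n → ℝ // w ≠ 0} × ℝ)
  let s : Finset ι := Finset.univ.sigma fun i => (c i).support
  have : Nonempty ι := ⟨0, ⟨1, one_ne_zero⟩, 0⟩
  obtain ⟨e, he⟩ := Finset.exists_sum_eq_sum_range (M := Fin n → ℝ) s
  refine ⟨s.card, fun j => single (e j).1 (r _ (e j).2.1.2) (c (e j).1 (e j).2),
    fun j => W _ (e j).2.1.2, fun j _ => (e j).2.2, fun j _ => hdet _ _, fun x hx => ?_⟩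
  rw [← he fun p => (single p.1 (r _ p.2.1.2) (c p.1 p.2)).mulVec
    (entApp σ ((W _ p.2.1.2).mulVec x + fun _ => p.2.2)), Finset.sum_sigma]
  have : Nonempty (Fin n) := ⟨0⟩
  refine euclNorm_le_of_abs_le _ hε.le fun i => ?_
  convert hc i x hx using 2
  rw [Pi.sub_apply]
  congr 1
  rw [Finset.sum_apply, Finset.sum_eq_single i]
  · rw [Finset.sum_apply]
    refine Finset.sum_congr rfl fun p _ => ?_
    rw [single_mulVec]
    simp [entApp, mulVec, hrow]
  · intro l _ hl
    simp [single_mulVec, hl.symm]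
  · simp
end

section
/- Let σ : ℝ → ℝ be Lipschitz continuous and not equal to any polynomial, let Ω ⊂ ℝⁿ be compact, let f : Ω → ℝⁿ be continuous, and let ε > 0. Then there exist N ∈ ℕ, a step size h > 0, weights J_j ∈ ℝ^{2n×2n} skew-symmetric, W_j ∈ ℝ^{2n×2n}, b_j ∈ ℝ^{2n}, η_j ∈ ℝ^{2n} for j = 0,…,N−1, and a flow map Φ_N : ℝ^{2n} → ℝ^{2n} such that for every x₀ ∈ ι(Ω) the recursion has an HDNN trajectory starting at x₀ = (p_0; q_0) with (p_N; q_N) = Φ_N(x₀), and sup_{x ∈ Ω} ‖f(x) − π(Φ_N(ι(x)))‖ ≤ ε, where ι : ℝⁿ → ℝ^{2n} is the injection ι(z) = (z; 0ₙ) and π : ℝ^{2n} → ℝⁿ is the projection π(p; q) = q onto the last n coordinates. -/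
open Matrix

/-- `(p_j, q_j)_{j=0}^{N}` is an HDNN trajectory (semi-implicit Euler recursion)
with step size `h`, activation `σ`, and weights `J_j, W_j, b_j, η_j`:
`(p_{j+1}; q_{j+1}) = (p_j; q_j) + h • J_j (W_jᵀ σ(W_j (p_{j+1}; q_j) + b_j) + η_j)`. -/
def IsHDNNTraj (n N : ℕ) (h : ℝ) (σ : ℝ → ℝ)
    (J W : ℕ → Matrix (Fin n ⊕ Fin n) (Fin n ⊕ Fin n) ℝ)
    (b η : ℕ → ((Fin n ⊕ Fin n) → ℝ))
    (p q : ℕ → (Fin n → ℝ)) : Prop :=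
  ∀ j < N,
    Sum.elim (p (j + 1)) (q (j + 1)) =
      Sum.elim (p j) (q j) +
        h • (J j).mulVec
          ((W j)ᵀ.mulVec (entApp σ ((W j).mulVec (Sum.elim (p (j + 1)) (q j)) + b j)) + η j)

/-- The injection `ι : ℝⁿ → ℝ²ⁿ`, `ι(z) = (z; 0)`. -/
def inj {n : ℕ} (z : Fin n → ℝ) : (Fin n ⊕ Fin n) → ℝ := Sum.elim z 0

/-- The projection `π : ℝ²ⁿ → ℝⁿ` onto the last `n` coordinates, `π(p; q) = q`. -/
def proj {n : ℕ} (v : (Fin n ⊕ Fin n) → ℝ) : Fin n → ℝ := fun i => v (Sum.inr i)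

open scoped fwdDiff

theorem abs_integral_sub_mul_le_of_lipschitz {K : NNReal} {g : ℝ → ℝ} (hg : LipschitzWith K g)
    (y d : ℝ) : |(∫ u in y..y + d, g u) - d * g y| ≤ K * d ^ 2 := by
  have hint : ∀ a b, IntervalIntegrable g MeasureTheory.volume a b :=
    fun a b => hg.continuous.intervalIntegrable a b
  have h : (∫ u in y..y + d, g u) - d * g y = ∫ u in y..y + d, (g u - g y) := by
    rw [intervalIntegral.integral_sub (hint _ _) (by simp)]
    simp
  rw [h, ← Real.norm_eq_abs]
  refine (intervalIntegral.norm_integral_le_of_norm_le_const (C := K * |d|) ?_).trans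
    (le_of_eq ?_)
  · intro u hu
    rw [← dist_eq_norm]
    refine (hg.dist_le_mul u y).trans ?_
    gcongr
    rw [Real.dist_eq]
    have := Set.abs_sub_left_of_mem_uIcc (Set.uIoc_subset_uIcc hu)
    simpa using this
  · rw [add_sub_cancel_left, mul_assoc, abs_mul_abs_self, sq]

/-- The moving average `y ↦ ∫ u in 0..δ, g (y + u)` has derivative `Δ_[δ] g`, with a quadratic
error bound when `g` is Lipschitz. -/
theorem abs_integral_shift_sub_le_of_lipschitz {K : NNReal} {g : ℝ → ℝ} (hg : LipschitzWith K g)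
    (δ y d : ℝ) :
    |(∫ u in (0 : ℝ)..δ, g (y + d + u)) - (∫ u in (0 : ℝ)..δ, g (y + u)) - d * Δ_[δ] g y|
      ≤ 2 * K * d ^ 2 := by
  have hint : ∀ a b, IntervalIntegrable g MeasureTheory.volume a b :=
    fun a b => hg.continuous.intervalIntegrable a b
  simp only [intervalIntegral.integral_comp_add_left, add_zero, fwdDiff]
  have e : (∫ u in y + d..y + d + δ, g u) - (∫ u in y..y + δ, g u)
      = (∫ u in y + δ..y + δ + d, g u) - ∫ u in y..y + d, g u := by
    have h1 := intervalIntegral.integral_add_adjacent_intervals (hint y (y + d))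
      (hint (y + d) (y + d + δ))
    have h2 := intervalIntegral.integral_add_adjacent_intervals (hint y (y + δ))
      (hint (y + δ) (y + δ + d))
    rw [add_right_comm y δ d] at *
    linarith
  rw [e]
  have h1 := abs_integral_sub_mul_le_of_lipschitz hg (y + δ) d
  have h2 := abs_integral_sub_mul_le_of_lipschitz hg y d
  rw [abs_le] at *
  constructor <;> linarith

theorem lipschitzWith_fwdDiff {K : NNReal} {g : ℝ → ℝ} (hg : LipschitzWith K g) (δ : ℝ) :
    LipschitzWith (K + K) (Δ_[δ] g) := by
  have h : LipschitzWith K fun y => g (y + δ) :=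
    LipschitzWith.of_dist_le_mul fun x y => by simpa using hg.dist_le_mul (x + δ) (y + δ)
  exact h.sub hg

theorem exists_lipschitzWith_fwdDiff_iter {K : NNReal} {g : ℝ → ℝ} (hg : LipschitzWith K g)
    (δ : ℝ) (k : ℕ) : ∃ K', LipschitzWith K' ((fwdDiff δ)^[k] g) := by
  induction k with
  | zero => exact ⟨K, hg⟩
  | succ k ih =>
    obtain ⟨K', h⟩ := ih
    rw [Function.iterate_succ_apply']
    exact ⟨_, lipschitzWith_fwdDiff h δ⟩

theorem exists_fwdDiff_fwdDiff_ne_zero {σ : ℝ → ℝ} (hc : Continuous σ)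
    (hσ : ¬ ∃ P : Polynomial ℝ, ∀ x : ℝ, σ x = P.eval x) :
    ∃ δ θ, Δ_[δ] (Δ_[δ] σ) θ ≠ 0 := by
  by_contra! h
  have mid : ∀ a b, σ a + σ b = 2 * σ ((a + b) / 2) := by
    intro a b
    have := h ((b - a) / 2) a
    simp only [fwdDiff] at this
    rw [show a + (b - a) / 2 = (a + b) / 2 by ring,
      show (a + b) / 2 + (b - a) / 2 = b by ring] at this
    linarith
  let φ : ℝ →+ ℝ := AddMonoidHom.mk' (fun x => σ x - σ 0) fun a b => by
    have h1 := mid a b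
    have h2 := mid (a + b) 0
    rw [add_zero] at h2
    linarith
  have hφ : Continuous φ := hc.sub continuous_const
  refine hσ ⟨Polynomial.C (σ 0) + Polynomial.X * Polynomial.C (φ 1), fun x => ?_⟩
  have hx : φ x = x * φ 1 := by simpa using (φ.toRealLinearMap hφ).map_smul x 1
  simp only [Polynomial.eval_add, Polynomial.eval_mul, Polynomial.eval_C, Polynomial.eval_X, ← hx]
  simp [φ]

theorem eq_zero_of_forall_abs_mul_le {c C : ℝ} (h : ∀ m : ℕ, |m * c| ≤ C) : c = 0 := by
  by_contra hc
  obtain ⟨m, hm⟩ := exists_nat_gt (C / |c|)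
  rw [div_lt_iff₀ (abs_pos.2 hc)] at hm
  have := h m
  rw [abs_mul, Nat.abs_cast] at this
  linarith

theorem fwdDiff_eq_zero_of_fwdDiff_fwdDiff_eq_zero {g : ℝ → ℝ} {C δ : ℝ} (hg : ∀ x, |g x| ≤ C)
    (h : Δ_[δ] (Δ_[δ] g) = 0) : Δ_[δ] g = 0 := by
  funext θ
  have hper : ∀ m : ℕ, Δ_[δ] g (θ + m * δ) = Δ_[δ] g θ := by
    intro m
    induction m with
    | zero => simp
    | succ m ih =>
      have := congrFun h (θ + m * δ)
      rw [fwdDiff, Pi.zero_apply, sub_eq_zero, ih] at this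
      rw [← this]
      push_cast
      ring_nf
  have hlin : ∀ m : ℕ, g (θ + m * δ) = g θ + m * Δ_[δ] g θ := by
    intro m
    induction m with
    | zero => simp
    | succ m ih =>
      have := hper m
      rw [fwdDiff, ih] at this
      push_cast
      rw [add_mul, one_mul, ← add_assoc]
      linarith
  refine eq_zero_of_forall_abs_mul_le (C := C + C) fun m => ?_
  rw [show m * Δ_[δ] g θ = g (θ + m * δ) - g θ by rw [hlin]; ring]
  exact (abs_sub _ _).trans (add_le_add (hg _) (hg _))

theorem exists_forall_exists_fwdDiff_iter_ne_zero {σ : ℝ → ℝ} {K : NNReal}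
    (hL : LipschitzWith K σ) (hσ : ¬ ∃ P : Polynomial ℝ, ∀ x : ℝ, σ x = P.eval x) :
    ∃ δ, ∀ k, ∃ θ, (fwdDiff δ)^[k] σ θ ≠ 0 := by
  obtain ⟨δ, θ, h⟩ := exists_fwdDiff_fwdDiff_ne_zero hL.continuous hσ
  refine ⟨δ, ?_⟩
  have hbdd : ∀ k, ∃ C, ∀ x, |(fwdDiff δ)^[k + 1] σ x| ≤ C := by
    intro k
    obtain ⟨K', h⟩ := exists_lipschitzWith_fwdDiff_iter hL δ k
    refine ⟨K' * |δ|, fun x => ?_⟩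
    rw [Function.iterate_succ_apply', fwdDiff, ← Real.dist_eq]
    simpa [Real.dist_eq] using h.dist_le_mul (x + δ) x
  have key : ∀ k, (fwdDiff δ)^[k + 2] σ ≠ 0 := by
    intro k
    induction k with
    | zero => exact fun h0 => h (congrFun h0 θ)
    | succ k ih =>
      intro h0
      obtain ⟨C, hC⟩ := hbdd k
      refine ih ?_
      rw [Function.iterate_succ_apply']
      refine fwdDiff_eq_zero_of_fwdDiff_fwdDiff_eq_zero hC ?_
      rwa [← Function.iterate_succ_apply' (fwdDiff δ), ← Function.iterate_succ_apply' (fwdDiff δ)]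
  intro k
  by_contra! h0
  refine key k ?_
  rw [add_comm, Function.iterate_add_apply, show (fwdDiff δ)^[k] σ = 0 from funext h0]
  funext x
  simp [fwdDiff]

section Closure

variable {X : Type*} [TopologicalSpace X] [CompactSpace X]

theorem exists_mem_eq_intervalIntegral {V : Submodule ℝ C(X, ℝ)} (hV : IsClosed (V : Set C(X, ℝ)))
    {G : ℝ → X → ℝ} (hG : Continuous (Function.uncurry G))
    (hmem : ∀ u, ∃ v ∈ V, ∀ x, v x = G u x) (a b : ℝ) :
    ∃ v ∈ V, ∀ x, v x = ∫ u in a..b, G u x := by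
  choose F hF hFG using hmem
  have : CompleteSpace V := hV.completeSpace_coe
  have hFc : Continuous F := ContinuousMap.continuous_of_continuous_uncurry _ <| by
    convert! hG using 1
    funext p
    exact hFG p.1 p.2
  let F' : ℝ → V := fun u => ⟨F u, hF u⟩
  have hF' : Continuous F' := hFc.subtype_mk hF
  refine ⟨(∫ u in a..b, F' u : V), Submodule.coe_mem _, fun x => ?_⟩
  let L : V →L[ℝ] ℝ := (ContinuousMap.evalCLM ℝ x).comp V.subtypeL
  have := L.intervalIntegral_comp_comm (𝕜 := ℝ) (μ := MeasureTheory.volume)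
    (hF'.intervalIntegrable a b)
  refine this.symm.trans ?_
  congr 1
  funext u
  exact hFG u x

theorem exists_mem_eq_pow_mul_fwdDiff {V : Submodule ℝ C(X, ℝ)} (hV : IsClosed (V : Set C(X, ℝ)))
    {K : NNReal} {g : ℝ → ℝ} (hg : LipschitzWith K g) (l : C(X, ℝ)) (k : ℕ)
    (h : ∀ s θ, ∃ v ∈ V, ∀ x, v x = l x ^ k * g (s * l x + θ)) (δ s θ : ℝ) :
    ∃ v ∈ V, ∀ x, v x = l x ^ (k + 1) * Δ_[δ] g (s * l x + θ) := by
  have hgc := hg.continuous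
  have havg : ∀ s, ∃ v ∈ V, ∀ x, v x = l x ^ k * ∫ u in (0 : ℝ)..δ, g (s * l x + θ + u) := by
    intro s
    obtain ⟨v, hv, hvx⟩ := exists_mem_eq_intervalIntegral hV
      (G := fun u x => l x ^ k * g (s * l x + θ + u)) (by fun_prop)
      (fun u => by simpa only [add_assoc] using h s (θ + u)) 0 δ
    exact ⟨v, hv, fun x => by rw [hvx, intervalIntegral.integral_const_mul]⟩
  choose v hv hvx using havg
  have hΔ : Continuous (Δ_[δ] g) := (lipschitzWith_fwdDiff hg δ).continuous
  let w : C(X, ℝ) := ⟨fun x => l x ^ (k + 1) * Δ_[δ] g (s * l x + θ), by fun_prop⟩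
  refine ⟨w, ?_, fun x => rfl⟩
  rw [← SetLike.mem_coe, ← hV.closure_eq, Metric.mem_closure_iff]
  intro ε hε
  set M : ℝ := 2 * K * ‖l‖ ^ (k + 2) with hM
  have hM0 : 0 ≤ M := by positivity
  set r : ℝ := ε / (M + 1) with hr
  have hr0 : 0 < r := by positivity
  refine ⟨r⁻¹ • (v (s + r) - v s), V.smul_mem _ (V.sub_mem (hv _) (hv _)), ?_⟩
  rw [dist_comm, ContinuousMap.dist_lt_iff hε]
  intro x
  have hb := abs_integral_shift_sub_le_of_lipschitz hg δ (s * l x + θ) (r * l x)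
  rw [show s * l x + θ + r * l x = (s + r) * l x + θ by ring] at hb
  have hlx : |l x| ≤ ‖l‖ := l.norm_coe_le_norm x
  rw [Real.dist_eq]
  calc |(r⁻¹ • (v (s + r) - v s)) x - w x|
      = |l x| ^ k * r⁻¹ * |(∫ u in (0 : ℝ)..δ, g ((s + r) * l x + θ + u))
          - (∫ u in (0 : ℝ)..δ, g (s * l x + θ + u)) - r * l x * Δ_[δ] g (s * l x + θ)| := by
        rw [← abs_pow, ← abs_of_pos (inv_pos.2 hr0), ← abs_mul, ← abs_mul,
          abs_of_pos (inv_pos.2 hr0)]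
        congr 1
        simp only [ContinuousMap.smul_apply, ContinuousMap.sub_apply, hvx, smul_eq_mul, w,
          ContinuousMap.coe_mk]
        field_simp
        ring
    _ ≤ |l x| ^ k * r⁻¹ * (2 * K * (r * l x) ^ 2) := by gcongr
    _ = 2 * K * |l x| ^ (k + 2) * r := by
        rw [← sq_abs (r * l x), abs_mul, abs_of_pos hr0]
        field_simp
        ring
    _ ≤ M * r := by rw [hM]; gcongr
    _ < ε := by
        rw [hr, mul_div_assoc', div_lt_iff₀ (by positivity)]
        linarith

/-- If a closed subspace of `C(X, ℝ)` contains all `σ (s * l + θ)` with `σ` Lipschitz and not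
polynomial, then it contains all powers of `l`. -/
theorem pow_mem_of_forall_comp_affine_mem {V : Submodule ℝ C(X, ℝ)}
    (hV : IsClosed (V : Set C(X, ℝ))) {K : NNReal} {σ : ℝ → ℝ} (hL : LipschitzWith K σ)
    (hσ : ¬ ∃ P : Polynomial ℝ, ∀ x : ℝ, σ x = P.eval x) (l : C(X, ℝ))
    (h : ∀ s θ, ∃ v ∈ V, ∀ x, v x = σ (s * l x + θ)) (k : ℕ) : l ^ k ∈ V := by
  obtain ⟨δ, hδ⟩ := exists_forall_exists_fwdDiff_iter_ne_zero hL hσ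
  have key : ∀ k s θ, ∃ v ∈ V, ∀ x, v x = l x ^ k * (fwdDiff δ)^[k] σ (s * l x + θ) := by
    intro k
    induction k with
    | zero => simpa using h
    | succ k ih =>
      intro s θ
      obtain ⟨K', hK'⟩ := exists_lipschitzWith_fwdDiff_iter hL δ k
      rw [Function.iterate_succ_apply']
      exact exists_mem_eq_pow_mul_fwdDiff hV hK' l k ih δ s θ
  obtain ⟨θ, hθ⟩ := hδ k
  obtain ⟨v, hv, hvx⟩ := key k 0 θ
  convert! V.smul_mem ((fwdDiff δ)^[k] σ θ)⁻¹ hv using 1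
  ext x
  simp only [ContinuousMap.pow_apply, ContinuousMap.smul_apply, hvx, smul_eq_mul, zero_mul,
    zero_add]
  field_simp

/-- A closed subspace of `C(X, ℝ)` containing `exp l` for every `l` in a point-separating additive
family is everything. -/
theorem eq_top_of_forall_exp_mem {V : Submodule ℝ C(X, ℝ)} (hV : IsClosed (V : Set C(X, ℝ)))
    {E : Type*} [AddGroup E] (l : E →+ C(X, ℝ))
    (hsep : ∀ x y, x ≠ y → ∃ a, l a x ≠ l a y) (h : ∀ a, NormedSpace.exp (l a) ∈ V) :
    V = ⊤ := by
  let M : Submonoid C(X, ℝ) :=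
    { carrier := Set.range fun a => NormedSpace.exp (l a)
      one_mem' := ⟨0, by simp⟩
      mul_mem' := by
        rintro _ _ ⟨a, rfl⟩ ⟨b, rfl⟩
        exact ⟨a + b, by simp [NormedSpace.exp_add]⟩ }
  let A : Subalgebra ℝ C(X, ℝ) := Algebra.adjoin ℝ M
  have hA : Subalgebra.toSubmodule A ≤ V := by
    rw [Algebra.adjoin_eq_span, Submonoid.closure_eq, Submodule.span_le]
    rintro _ ⟨a, rfl⟩
    exact h a
  have hAsep : A.SeparatesPoints := by
    intro x y hxy
    obtain ⟨a, ha⟩ := hsep x y hxy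
    refine ⟨_, ⟨NormedSpace.exp (l a), Algebra.subset_adjoin ⟨a, rfl⟩, rfl⟩, ?_⟩
    have hev : ∀ z, NormedSpace.exp (l a) z = Real.exp (l a z) := by
      intro z
      rw [Real.exp_eq_exp_ℝ]
      exact NormedSpace.map_exp (ContinuousMap.evalAlgHom ℝ ℝ z)
        (continuous_eval_const z) (l a)
    change NormedSpace.exp (l a) x ≠ NormedSpace.exp (l a) y
    rw [hev, hev]
    exact fun h' => ha (Real.exp_injective h')
  have htop := ContinuousMap.subalgebra_topologicalClosure_eq_top_of_separatesPoints A hAsep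
  rw [eq_top_iff]
  intro g _
  have hg : g ∈ A.topologicalClosure := htop ▸ Algebra.mem_top
  exact closure_minimal hA hV hg

end Closure

/-- The function `x ↦ σ (a ⬝ᵥ x + θ)` on `Ω`. -/
def ridge {n : ℕ} (Ω : Set (Fin n → ℝ)) (σ : C(ℝ, ℝ)) (p : (Fin n → ℝ) × ℝ) : C(Ω, ℝ) :=
  ⟨fun x => σ (p.1 ⬝ᵥ x.1 + p.2), 
    σ.continuous.comp <|
      (continuous_const.dotProduct continuous_subtype_val).add continuous_const⟩

/-- Universal approximation by shallow networks whose activation is Lipschitz and not polynomial. -/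
theorem closure_span_range_ridge_eq_top {n : ℕ} {Ω : Set (Fin n → ℝ)} (hΩ : IsCompact Ω)
    {K : NNReal} (σ : C(ℝ, ℝ)) (hL : LipschitzWith K σ)
    (hσ : ¬ ∃ P : Polynomial ℝ, ∀ x : ℝ, σ x = P.eval x) :
    (Submodule.span ℝ (Set.range (ridge Ω σ))).topologicalClosure = ⊤ := by
  have : CompactSpace Ω := isCompact_iff_compactSpace.1 hΩ
  set V := (Submodule.span ℝ (Set.range (ridge Ω σ))).topologicalClosure
  have hV : IsClosed (V : Set C(Ω, ℝ)) := Submodule.isClosed_topologicalClosure _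
  let l : (Fin n → ℝ) →+ C(Ω, ℝ) :=
    AddMonoidHom.mk' (fun a => ⟨fun x => a ⬝ᵥ x.1, continuous_const.dotProduct continuous_subtype_val⟩)
      fun a b => by ext x; simp [add_dotProduct]
  have hl : ∀ a x, l a x = a ⬝ᵥ x.1 := fun a x => rfl
  refine eq_top_of_forall_exp_mem hV l ?_ ?_
  · intro x y hxy
    obtain ⟨i, hi⟩ := Function.ne_iff.1 (Subtype.coe_injective.ne hxy)
    exact ⟨Pi.single i 1, by simpa [hl] using hi⟩
  · intro a
    have hpow := pow_mem_of_forall_comp_affine_mem hV hL hσ (l a) fun s θ =>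
      ⟨ridge Ω σ (s • a, θ), Submodule.le_topologicalClosure _
        (Submodule.subset_span ⟨_, rfl⟩), fun x => by simp [ridge, hl, smul_dotProduct]⟩
    exact hV.mem_of_tendsto (NormedSpace.exp_series_hasSum_exp' (𝕂 := ℝ) (l a))
      (Filter.Eventually.of_forall fun s => V.sum_mem fun k _ => V.smul_mem _ (hpow k))

theorem exists_sum_ridge_near {n : ℕ} {Ω : Set (Fin n → ℝ)} (hΩ : IsCompact Ω)
    {K : NNReal} {σ : ℝ → ℝ} (hL : LipschitzWith K σ)
    (hσ : ¬ ∃ P : Polynomial ℝ, ∀ x : ℝ, σ x = P.eval x) {f : (Fin n → ℝ) → ℝ}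
    (hf : ContinuousOn f Ω) {ε : ℝ} (hε : 0 < ε) :
    ∃ (m : ℕ) (c : Fin m → ℝ) (a : Fin m → (Fin n → ℝ)) (θ : Fin m → ℝ),
      ∀ x ∈ Ω, |f x - ∑ k, c k * σ (a k ⬝ᵥ x + θ k)| < ε := by
  have : CompactSpace Ω := isCompact_iff_compactSpace.1 hΩ
  let F : C(Ω, ℝ) := ⟨Ω.domRestrict f, hf.domRestrict⟩
  let s : C(ℝ, ℝ) := ⟨σ, hL.continuous⟩
  have hF : F ∈ closure (Submodule.span ℝ (Set.range (ridge Ω s)) : Set C(Ω, ℝ)) := by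
    rw [← Submodule.topologicalClosure_coe, closure_span_range_ridge_eq_top hΩ s hL hσ]
    trivial
  obtain ⟨g, hg, hd⟩ := Metric.mem_closure_iff.1 hF ε hε
  obtain ⟨m, c, v, rfl⟩ := Submodule.mem_span_set'.1 hg
  choose p hp using fun k => (v k).2
  refine ⟨m, c, fun k => (p k).1, fun k => (p k).2, fun x hx => ?_⟩
  have := (ContinuousMap.dist_lt_iff hε).1 hd ⟨x, hx⟩
  rw [Real.dist_eq] at this
  convert! this using 3
  rw [ContinuousMap.sum_apply]
  refine Finset.sum_congr rfl fun k _ => ?_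
  rw [ContinuousMap.smul_apply, ← hp k]
  rfl

/-- Every ridge function is the increment of `q` in some layer that leaves `p` unchanged. -/
theorem exists_mulVec_eq_ridge_smul {n : ℕ} (σ : ℝ → ℝ) (a c : Fin n → ℝ) (θ : ℝ) :
    ∃ (X A : Matrix (Fin n) (Fin n) ℝ) (b η : Fin n → ℝ),
      ∀ x, X *ᵥ (Aᵀ *ᵥ entApp σ (A *ᵥ x + b) + η) = σ (a ⬝ᵥ x + θ) • c := by
  by_cases ha : a = 0
  · exact ⟨1, 0, 0, σ θ • c, fun x => by simp [ha]⟩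
  · obtain ⟨i, hi⟩ := Function.ne_iff.1 ha
    rw [Pi.zero_apply] at hi
    refine ⟨vecMulVec c (Pi.single i (a i)⁻¹), vecMulVec (Pi.single i 1) a,
      fun _ => θ, 0, fun x => ?_⟩
    rw [add_zero, transpose_vecMulVec, vecMulVec_mulVec, vecMulVec_mulVec, vecMulVec_mulVec]
    ext j
    simp [entApp, dotProduct_smul, hi]
    field_simp

/-- The semi-implicit Euler recursion with `J = [0, -Xᵀ; X, 0]` and `W = [A, 0; 0, 0]` fixes `p` and
adds `X (Aᵀ σ (A p + b) + η)` to `q`. -/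
theorem isHDNNTraj_of_add {n : ℕ} (σ : ℝ → ℝ) (N : ℕ) (X A : ℕ → Matrix (Fin n) (Fin n) ℝ)
    (b η : ℕ → (Fin n → ℝ)) (x : Fin n → ℝ) (q : ℕ → (Fin n → ℝ))
    (hq : ∀ j < N, q (j + 1) = q j + X j *ᵥ ((A j)ᵀ *ᵥ entApp σ (A j *ᵥ x + b j) + η j)) :
    IsHDNNTraj n N 1 σ (fun j => fromBlocks 0 (-(X j)ᵀ) (X j) 0)
      (fun j => fromBlocks (A j) 0 0 0) (fun j => Sum.elim (b j) 0) (fun j => Sum.elim (η j) 0)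
      (fun _ => x) q := by
  intro j hj
  have h : ∀ u : Fin n → ℝ,
      entApp σ (Sum.elim u 0) = Sum.elim (entApp σ u) (entApp σ (0 : Fin n → ℝ)) := by
    intro u
    ext i
    cases i <;> rfl
  have h' : ∀ u v : Fin n → ℝ, Sum.elim u 0 + Sum.elim v 0 = Sum.elim (u + v) (0 : Fin n → ℝ) := by
    intro u v
    ext i
    cases i <;> simp
  simp only [fromBlocks_transpose, fromBlocks_mulVec, Sum.elim_comp_inl, Sum.elim_comp_inr,
    zero_mulVec, add_zero, transpose_zero, h, h', mulVec_zero, one_smul, hq j hj]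
  ext i
  cases i <;> simp

/-- UAP of the HDNN flow map composed with the injection `ι(z) = (z;0)` and the
projection `π(p;q) = q`: `sup_{x∈Ω} ‖f(x) − π(Φ_N(ι(x)))‖ ≤ ε`. -/
theorem hdnn_flow_UAP {n : ℕ} (σ : ℝ → ℝ)
    (hσLip : ∃ K : NNReal, LipschitzWith K σ)
    (hσpoly : ¬ ∃ P : Polynomial ℝ, ∀ x : ℝ, σ x = P.eval x)
    (Ω : Set (Fin n → ℝ)) (hΩ : IsCompact Ω)
    (f : (Fin n → ℝ) → (Fin n → ℝ)) (hf : ContinuousOn f Ω)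
    (ε : ℝ) (hε : 0 < ε) :
    ∃ (N : ℕ) (h : ℝ) (J W : ℕ → Matrix (Fin n ⊕ Fin n) (Fin n ⊕ Fin n) ℝ)
      (b η : ℕ → ((Fin n ⊕ Fin n) → ℝ))
      (Φ : ((Fin n ⊕ Fin n) → ℝ) → ((Fin n ⊕ Fin n) → ℝ)),
      0 < h ∧
      (∀ j < N, (J j)ᵀ = -(J j)) ∧
      (∀ x₀ ∈ inj '' Ω, ∃ p q : ℕ → (Fin n → ℝ),
        IsHDNNTraj n N h σ J W b η p q ∧
        Sum.elim (p 0) (q 0) = x₀ ∧ Sum.elim (p N) (q N) = Φ x₀) ∧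
      (∀ x ∈ Ω, euclNorm (f x - proj (Φ (inj x))) ≤ ε) := by
  obtain ⟨K, hL⟩ := hσLip
  set δ : ℝ := ε / (n + 1) with hδ
  have hδ0 : 0 < δ := by positivity
  choose m c a θ hnear using fun i : Fin n =>
    exists_sum_ridge_near hΩ hL hσpoly (continuousOn_pi.1 hf i) hδ0
  let e := Fintype.equivFin ((i : Fin n) × Fin (m i))
  choose X A b η hlayer using fun k : (i : Fin n) × Fin (m i) =>
    exists_mulVec_eq_ridge_smul σ (a k.1 k.2) (Pi.single k.1 (c k.1 k.2)) (θ k.1 k.2)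
  set N := Fintype.card ((i : Fin n) × Fin (m i))
  let ext0 : {β : Type} → [Zero β] → ((i : Fin n) × Fin (m i) → β) → ℕ → β :=
    fun g j => if h : j < N then g (e.symm ⟨j, h⟩) else 0
  let q : (Fin n → ℝ) → ℕ → (Fin n → ℝ) := fun x j => ∑ k ∈ Finset.range j,
    ext0 X k *ᵥ ((ext0 A k)ᵀ *ᵥ entApp σ (ext0 A k *ᵥ x + ext0 b k) + ext0 η k)
  have hqN : ∀ x i, q x N i = ∑ k, c i k * σ (a i k ⬝ᵥ x + θ i k) := by
    intro x i
    have h1 : q x N = ∑ k : (i : Fin n) × Fin (m i),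
        σ (a k.1 k.2 ⬝ᵥ x + θ k.1 k.2) • Pi.single k.1 (c k.1 k.2) := by
      simp only [q]
      rw [Finset.sum_range, ← e.symm.sum_comp]
      refine Finset.sum_congr rfl fun k _ => ?_
      simp only [ext0, k.2, dif_pos, Fin.eta]
      exact hlayer _ x
    rw [h1, Fintype.sum_sigma, Finset.sum_apply, Finset.sum_eq_single i]
    · simp [mul_comm]
    · intro i' _ hi'
      simp [Pi.single_eq_of_ne hi'.symm]
    · simp
  refine ⟨N, 1, fun j => fromBlocks 0 (-(ext0 X j)ᵀ) (ext0 X j) 0,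
    fun j => fromBlocks (ext0 A j) 0 0 0, fun j => Sum.elim (ext0 b j) 0,
    fun j => Sum.elim (ext0 η j) 0,
    fun v => Sum.elim (v ∘ Sum.inl) (q (v ∘ Sum.inl) N), one_pos, ?_, ?_, ?_⟩
  · intro j _
    simp [fromBlocks_transpose, fromBlocks_neg]
  · rintro _ ⟨x, -, rfl⟩
    refine ⟨fun _ => x, q x, isHDNNTraj_of_add σ N _ _ _ _ x (q x) fun j _ =>
      Finset.sum_range_succ _ _, ?_, ?_⟩
    · simp [q, inj]
    · simp [inj]
  · intro x hx
    refine Real.sqrt_le_iff.2 ⟨hε.le, ?_⟩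
    calc ∑ i, (f x - proj (Sum.elim (inj x ∘ Sum.inl) (q (inj x ∘ Sum.inl) N))) i ^ 2
        ≤ ∑ _i : Fin n, δ ^ 2 := by
          refine Finset.sum_le_sum fun i _ => sq_le_sq' ?_ ?_ <;>
          · have := abs_lt.1 (hnear i x hx)
            simp only [Pi.sub_apply, proj, inj, Sum.elim_inr, Sum.elim_comp_inl, hqN]
            linarith
      _ = n * δ ^ 2 := by simp
      _ ≤ ((n + 1) * δ) ^ 2 := by nlinarith [sq_nonneg δ, (Nat.cast_nonneg n : (0 : ℝ) ≤ n)]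
      _ = ε ^ 2 := by rw [hδ]; field_simp
end
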